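/- If R_1 ↦ R_2 is an exchange move or a type →II stabilization or destabilization, then the number of double (self-intersection) points of Γ_→II(R_1) equals the number of double points of Γ_→II(R_2). Consequently the triple ω_→II(R) = (k, l, m), where (k,l) is the homology class of Γ_→II(R) and m its number of double points, is an invariant of the equivalence class [R]_→II. -/

import Mathlib

open Set

noncomputable section

/-- The circle `S¹`, modeled as `ℝ/ℤ`. -/
abbrev 𝕊 : Type := AddCircle (1 : ℝ)

/-- The torus `T² = S¹ × S¹`. -/
abbrev Torus : Type := 𝕊 × 𝕊

instance : Fact ((0:ℝ) < 1) := ⟨one_pos⟩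

/-- The representative of a point of `S¹` in `[0,1)`. -/
noncomputable def toIco (x : 𝕊) : ℝ := (AddCircle.equivIco 1 0 x).1

/-- The closed positively oriented arc `[a;b]` in `S¹`. -/
def closedArc (a b : 𝕊) : Set 𝕊 := {x | toIco (x - a) ≤ toIco (b - a)}

/-- The open positively oriented arc `(a;b)` in `S¹`. -/
def openArc (a b : 𝕊) : Set 𝕊 := {x | 0 < toIco (x - a) ∧ toIco (x - a) < toIco (b - a)}

/-- An oriented rectangular diagram of a link. -/
structure RectDiagram where
  pos : Finset Torus
  neg : Finset Torus
  disj : Disjoint pos neg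
  nonempty : (pos ∪ neg).Nonempty
  thetaEq : pos.image Prod.fst = neg.image Prod.fst
  phiEq : pos.image Prod.snd = neg.image Prod.snd
  thetaInjPos : Set.InjOn Prod.fst (pos : Set Torus)
  thetaInjNeg : Set.InjOn Prod.fst (neg : Set Torus)
  phiInjPos : Set.InjOn Prod.snd (pos : Set Torus)
  phiInjNeg : Set.InjOn Prod.snd (neg : Set Torus)

namespace RectDiagram

/-- The set of vertices of a rectangular diagram. -/
def verts (R : RectDiagram) : Finset Torus := R.pos ∪ R.neg

/-- The projection of the vertex set to the `θ`-circle. -/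
def pθ (R : RectDiagram) : Finset 𝕊 := R.verts.image Prod.fst

/-- The projection of the vertex set to the `φ`-circle. -/
def pφ (R : RectDiagram) : Finset 𝕊 := R.verts.image Prod.snd

/-- Vertical edges: unordered pairs of distinct vertices with equal `θ`-coordinate. -/
def vertEdges (R : RectDiagram) : Set (Finset Torus) :=
  {e | ∃ u ∈ R.verts, ∃ v ∈ R.verts, u ≠ v ∧ u.1 = v.1 ∧ e = {u, v}}

/-- Horizontal edges: unordered pairs of distinct vertices with equal `φ`-coordinate. -/
def horizEdges (R : RectDiagram) : Set (Finset Torus) :=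
  {e | ∃ u ∈ R.verts, ∃ v ∈ R.verts, u ≠ v ∧ u.2 = v.2 ∧ e = {u, v}}

end RectDiagram

/-- A set of one, two, or three consecutive corners of the rectangle
`[θ₁;θ₂] × [φ₁;φ₂]` (in the cyclic order of the corners). -/
def ConsecCorners (θ₁ θ₂ φ₁ φ₂ : 𝕊) (s : Set Torus) : Prop :=
  let c₁ : Torus := (θ₁, φ₁); let c₂ : Torus := (θ₂, φ₁)
  let c₃ : Torus := (θ₂, φ₂); let c₄ : Torus := (θ₁, φ₂)
  s = {c₁} ∨ s = {c₂} ∨ s = {c₃} ∨ s = {c₄} ∨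
  s = {c₁, c₂} ∨ s = {c₂, c₃} ∨ s = {c₃, c₄} ∨ s = {c₄, c₁} ∨
  s = {c₁, c₂, c₃} ∨ s = {c₂, c₃, c₄} ∨ s = {c₃, c₄, c₁} ∨ s = {c₄, c₁, c₂}

/-- An elementary move `R₁ ↦ R₂` with the given data `θ₁, θ₂, φ₁, φ₂`. -/
def ElemMoveData (R₁ R₂ : RectDiagram) (θ₁ θ₂ φ₁ φ₂ : 𝕊) : Prop :=
  θ₁ ≠ θ₂ ∧ φ₁ ≠ φ₂ ∧
  symmDiff (↑R₁.verts : Set Torus) ↑R₂.verts = ({θ₁, θ₂} : Set 𝕊) ×ˢ ({φ₁, φ₂} : Set 𝕊) ∧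
  (closedArc θ₁ θ₂ ×ˢ closedArc φ₁ φ₂) ∩ ((↑R₁.verts : Set Torus) ∪ ↑R₂.verts)
    = symmDiff (↑R₁.verts : Set Torus) ↑R₂.verts ∧
  (∃ s : Set Torus, ConsecCorners θ₁ θ₂ φ₁ φ₂ s ∧
    (↑R₁.verts : Set Torus) ∩ (({θ₁, θ₂} : Set 𝕊) ×ˢ ({φ₁, φ₂} : Set 𝕊)) = s ∧
    (({θ₁, θ₂} : Set 𝕊) ×ˢ ({φ₁, φ₂} : Set 𝕊)) \ s ⊆ (↑R₂.verts : Set Torus)) ∧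
  ((↑R₁.pos : Set Torus) ∩ ↑R₂.verts = (↑R₁.verts : Set Torus) ∩ ↑R₂.pos)

/-- An elementary move of rectangular diagrams. -/
def ElemMove (R₁ R₂ : RectDiagram) : Prop :=
  ∃ θ₁ θ₂ φ₁ φ₂, ElemMoveData R₁ R₂ θ₁ θ₂ φ₁ φ₂

/-- An exchange move. -/
def ExchangeMove (R₁ R₂ : RectDiagram) : Prop :=
  ElemMove R₁ R₂ ∧ R₁.verts.card = R₂.verts.card

/-- A stabilization move. -/
def Stab (R₁ R₂ : RectDiagram) : Prop :=
  ElemMove R₁ R₂ ∧ R₂.verts.card = R₁.verts.card + 2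

/-- A destabilization move. -/
def Destab (R₁ R₂ : RectDiagram) : Prop :=
  ElemMove R₁ R₂ ∧ R₁.verts.card = R₂.verts.card + 2

/-- The four oriented types of stabilizations: `→I`, `←I`, `→II`, `←II`. -/
inductive OType | rI | lI | rII | lII
deriving DecidableEq

/-- A stabilization `R₁ ↦ R₂` with data `θ₁, θ₂, φ₁, φ₂` has oriented type `T`:
`v` is the (unique) vertex of `R₁` in the rectangle, type I means
`v ∈ {(θ₁,φ₁),(θ₂,φ₂)}`, type II means `v ∈ {(θ₁,φ₂),(θ₂,φ₁)}`, and the arrow is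
`→` or `←` according to the sign of `(θ₂,φ₀)` in `R₂`, where
`{θ₁,θ₂} × {φ₀} ⊆ R₂`. -/
def StabTypeData (R₁ R₂ : RectDiagram) (θ₁ θ₂ φ₁ φ₂ : 𝕊) (T : OType) : Prop :=
  ∃ v ∈ (↑R₁.verts : Set Torus) ∩ (closedArc θ₁ θ₂ ×ˢ closedArc φ₁ φ₂),
    ∃ φ₀ ∈ ({φ₁, φ₂} : Set 𝕊), (θ₁, φ₀) ∈ R₂.verts ∧ (θ₂, φ₀) ∈ R₂.verts ∧
    (match T with
     | .rI => (v = (θ₁, φ₁) ∨ v = (θ₂, φ₂)) ∧ (θ₂, φ₀) ∈ R₂.pos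
     | .lI => (v = (θ₁, φ₁) ∨ v = (θ₂, φ₂)) ∧ (θ₂, φ₀) ∈ R₂.neg
     | .rII => (v = (θ₁, φ₂) ∨ v = (θ₂, φ₁)) ∧ (θ₂, φ₀) ∈ R₂.pos
     | .lII => (v = (θ₁, φ₂) ∨ v = (θ₂, φ₁)) ∧ (θ₂, φ₀) ∈ R₂.neg)

/-- A stabilization of oriented type `T`. -/
def StabOfType (R₁ R₂ : RectDiagram) (T : OType) : Prop :=
  ∃ θ₁ θ₂ φ₁ φ₂, ElemMoveData R₁ R₂ θ₁ θ₂ φ₁ φ₂ ∧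
    R₂.verts.card = R₁.verts.card + 2 ∧ StabTypeData R₁ R₂ θ₁ θ₂ φ₁ φ₂ T

/-- A destabilization of oriented type `T` (the type is read off from the inverse
stabilization `R₂ ↦ R₁`). -/
def DestabOfType (R₁ R₂ : RectDiagram) (T : OType) : Prop :=
  ∃ θ₁ θ₂ φ₁ φ₂, ElemMoveData R₁ R₂ θ₁ θ₂ φ₁ φ₂ ∧
    R₁.verts.card = R₂.verts.card + 2 ∧ StabTypeData R₂ R₁ θ₁ θ₂ φ₁ φ₂ T

/-- The union of staircase curves `Γ_→II(R)` on the torus. -/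
def Gamma (R : RectDiagram) : Set Torus :=
  {p | ∃ θ₀ φ₁ φ₂, (θ₀, φ₁) ∈ R.pos ∧ (θ₀, φ₂) ∈ R.neg ∧ p.1 = θ₀ ∧ p.2 ∈ closedArc φ₁ φ₂} ∪
  {p | ∃ θ₁ θ₂ φ₀, (θ₁, φ₀) ∈ R.neg ∧ (θ₂, φ₀) ∈ R.pos ∧ p.2 = φ₀ ∧ p.1 ∈ closedArc θ₁ θ₂}

/-- Number of intersection points of a subset of the torus with the meridian `{θ₀} × S¹`. -/
def merCount (A : Set Torus) (θ₀ : 𝕊) : ℕ := (A ∩ {p | p.1 = θ₀}).ncard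

/-- Number of intersection points of a subset of the torus with the longitude `S¹ × {φ₀}`. -/
def lonCount (A : Set Torus) (φ₀ : 𝕊) : ℕ := (A ∩ {p | p.2 = φ₀}).ncard

/-- `(k,l)` is the homology class of `Γ_→II(R)` in `H₁(T²;ℤ)`: it counts the
intersections of `Γ_→II(R)` with generic meridians and longitudes respectively. -/
def IsHomClass (R : RectDiagram) (k l : ℕ) : Prop :=
  (∀ θ₀ : 𝕊, θ₀ ∉ R.pθ → merCount (Gamma R) θ₀ = k) ∧
  (∀ φ₀ : 𝕊, φ₀ ∉ R.pφ → lonCount (Gamma R) φ₀ = l)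

/-- `p` lies in the relative interior of a vertical segment of `Γ_→II(R)`. -/
def OnVertInt (R : RectDiagram) (p : Torus) : Prop :=
  ∃ θ₀ φ₁ φ₂, (θ₀, φ₁) ∈ R.pos ∧ (θ₀, φ₂) ∈ R.neg ∧ p.1 = θ₀ ∧ p.2 ∈ openArc φ₁ φ₂

/-- `p` lies in the relative interior of a horizontal segment of `Γ_→II(R)`. -/
def OnHorizInt (R : RectDiagram) (p : Torus) : Prop :=
  ∃ θ₁ θ₂ φ₀, (θ₁, φ₀) ∈ R.neg ∧ (θ₂, φ₀) ∈ R.pos ∧ p.2 = φ₀ ∧ p.1 ∈ openArc θ₁ θ₂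

/-- The set of double (self-intersection) points of `Γ_→II(R)`. -/
def DoublePts (R : RectDiagram) : Set Torus := {p | OnVertInt R p ∧ OnHorizInt R p}

/-- An exchange move or a type-`T` stabilization or destabilization. -/
def MoveOfType (T : OType) (R₁ R₂ : RectDiagram) : Prop :=
  ExchangeMove R₁ R₂ ∨ StabOfType R₁ R₂ T ∨ DestabOfType R₁ R₂ T

/-- The equivalence generated by exchange moves and type-`T` (de)stabilizations:
`[R₁]_T = [R₂]_T`. -/
def EquivOfType (T : OType) : RectDiagram → RectDiagram → Prop :=
  Relation.ReflTransGen (MoveOfType T)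

/-- An (ambient) isotopy of the torus: a continuous family of homeomorphisms
starting from the identity. -/
def Isotopy (H : ℝ → Torus ≃ₜ Torus) : Prop :=
  Continuous (fun q : ℝ × Torus => H q.1 q.2) ∧ H 0 = Homeomorph.refl Torus

/-- `A` is isotopic to `B` by an ambient isotopy of `T²` fixed on `X`. -/
def IsotopicRelFixed (A B X : Set Torus) : Prop :=
  ∃ H : ℝ → Torus ≃ₜ Torus, Isotopy H ∧ (∀ t : ℝ, ∀ x ∈ X, H t x = x) ∧ (H 1) '' A = B

/-- `F` is an embedded closed disc in the torus. -/
def IsClosedDisc (F : Set Torus) : Prop :=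
  Nonempty (↥F ≃ₜ ↥(Metric.closedBall (0 : ℝ × ℝ) 1))

/-- `F` is an embedded closed annulus in the torus. -/
def IsClosedAnnulus (F : Set Torus) : Prop :=
  Nonempty (↥F ≃ₜ (𝕊 × ↥(Set.Icc (0:ℝ) 1)))

/-- A self-homeomorphism of `S¹` is orientation-preserving if it preserves the
cyclic order (sends points of open positively oriented arcs to points of the
corresponding open positively oriented arcs). -/
def OrientPres (f : 𝕊 ≃ₜ 𝕊) : Prop :=
  ∀ a b c : 𝕊, b ∈ openArc a c → f b ∈ openArc (f a) (f c)

/-- Combinatorial equivalence of rectangular diagrams: related by a product of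
orientation-preserving self-homeomorphisms of the two circle factors. -/
def CombEquiv (R R' : RectDiagram) : Prop :=
  ∃ f g : 𝕊 ≃ₜ 𝕊, OrientPres f ∧ OrientPres g ∧
    (fun p : Torus => (f p.1, g p.2)) '' ↑R.pos = ↑R'.pos ∧
    (fun p : Torus => (f p.1, g p.2)) '' ↑R.neg = ↑R'.neg

/-- `R` and `R'` have the same `→II`-homology type. -/
def SameHomType (R R' : RectDiagram) : Prop :=
  ∃ R'' : RectDiagram, CombEquiv R' R'' ∧
    IsotopicRelFixed (Gamma R) (Gamma R'') (DoublePts R)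


/-! ### Basic arithmetic of arcs -/

theorem ti_nonneg (x : 𝕊) : 0 ≤ toIco x := (AddCircle.equivIco 1 0 x).2.1

theorem ti_lt (x : 𝕊) : toIco x < 1 := by
  have := (AddCircle.equivIco 1 0 x).2.2
  simpa [toIco] using this

theorem ti_coe (x : 𝕊) : ((toIco x : ℝ) : 𝕊) = x := (AddCircle.equivIco 1 0).symm_apply_apply x

theorem ti_of_mem (r : ℝ) (h0 : 0 ≤ r) (h1 : r < 1) : toIco (r : 𝕊) = r := by
  have h : r ∈ Set.Ico (0 : ℝ) (0 + 1) := ⟨h0, by simpa using h1⟩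
  have := (AddCircle.equivIco (1 : ℝ) 0).apply_symm_apply ⟨r, h⟩
  exact congrArg Subtype.val this

theorem ti_zero : toIco 0 = 0 := by
  simpa using ti_of_mem 0 le_rfl one_pos

theorem ti_eq_zero {x : 𝕊} (h : toIco x = 0) : x = 0 := by
  rw [← ti_coe x, h]; simp

theorem ti_sub (a x y : 𝕊) :
    toIco (x - y) = toIco (x - a) - toIco (y - a) +
      (if toIco (x - a) < toIco (y - a) then 1 else 0) := by
  have hx := ti_coe (x - a)
  have hy := ti_coe (y - a)
  have e : x - y = ((toIco (x - a) - toIco (y - a) : ℝ) : 𝕊) := by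
    rw [AddCircle.coe_sub, hx, hy]; abel
  have := ti_nonneg (x - a)
  have := ti_nonneg (y - a)
  have := ti_lt (x - a)
  have := ti_lt (y - a)
  split_ifs with h
  · have e' : x - y = ((toIco (x - a) - toIco (y - a) + 1 : ℝ) : 𝕊) := by
      rw [e]
      have h1 : ((1 : ℝ) : 𝕊) = 0 := AddCircle.coe_period 1
      rw [AddCircle.coe_add, h1, add_zero]
    rw [e']
    apply ti_of_mem <;> linarith
  · rw [e, ti_of_mem] <;> linarith

theorem ti_inj (a : 𝕊) {x y : 𝕊} (h : toIco (x - a) = toIco (y - a)) : x = y := by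
  have : x - a = y - a := by rw [← ti_coe (x - a), h, ti_coe]
  simpa using this

open Classical in
/-- Indicator of the half-open arc `[a;b)`. -/
def hI (a b x : 𝕊) : ℤ := if toIco (x - a) < toIco (b - a) then 1 else 0

theorem hI_real (a b x : 𝕊) (h : a ≠ b) :
    ((hI a b x : ℤ) : ℝ) = toIco (b - a) - toIco (x - a) + toIco (x - b) := by
  have hb : toIco (b - a) ≠ 0 := fun h0 => h (sub_eq_zero.1 (ti_eq_zero h0)).symm
  rw [ti_sub a x b, hI]
  split_ifs <;> push_cast <;> ring

theorem hI_left (a b : 𝕊) (h : a ≠ b) : hI a b a = 1 := by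
  have hb : toIco (b - a) ≠ 0 := fun h0 => h (sub_eq_zero.1 (ti_eq_zero h0)).symm
  have := ti_nonneg (b - a)
  rw [hI, if_pos]
  rw [sub_self, ti_zero]
  exact lt_of_le_of_ne this hb.symm

theorem hI_right (a b : 𝕊) : hI a b b = 0 := by simp [hI]

theorem hI_add_left (p a b x : 𝕊) (h : p ∉ closedArc a b) :
    hI p b x = hI p a x + hI a b x := by
  simp only [closedArc, Set.mem_ofPred_eq, not_le] at h
  simp only [hI]
  rw [ti_sub a x p, ti_sub a b p, ti_sub a a p]
  rw [sub_self, ti_zero]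
  have := ti_nonneg (x - a)
  have := ti_nonneg (b - a)
  have := ti_nonneg (p - a)
  have := ti_lt (x - a)
  have := ti_lt (b - a)
  have := ti_lt (p - a)
  grind

theorem hI_add_right (q a b x : 𝕊) (h : q ∉ closedArc a b) :
    hI a q x = hI a b x + hI b q x := by
  simp only [closedArc, Set.mem_ofPred_eq, not_le] at h
  simp only [hI]
  rw [ti_sub a x b, ti_sub a q b]
  have := ti_nonneg (x - a)
  have := ti_nonneg (b - a)
  have := ti_nonneg (q - a)
  have := ti_lt (x - a)
  have := ti_lt (b - a)
  have := ti_lt (q - a)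
  grind

theorem hI_compl (a b x : 𝕊) (h : a ≠ b) : hI b a x = 1 - hI a b x := by
  have hb : toIco (b - a) ≠ 0 := fun h0 => h (sub_eq_zero.1 (ti_eq_zero h0)).symm
  simp only [hI]
  rw [ti_sub a x b, ti_sub a a b, sub_self, ti_zero]
  have := ti_nonneg (x - a)
  have := ti_nonneg (b - a)
  have := ti_lt (x - a)
  have := ti_lt (b - a)
  grind

theorem hI_const (a b p q : 𝕊) (hp : p ∉ closedArc a b) (hq : q ∉ closedArc a b) :
    hI p q a = hI p q b := by
  simp only [closedArc, Set.mem_ofPred_eq, not_le] at hp hq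
  simp only [hI]
  rw [ti_sub a a p, ti_sub a q p, ti_sub a b p, sub_self, ti_zero]
  have := ti_nonneg (p - a)
  have := ti_nonneg (b - a)
  have := ti_nonneg (q - a)
  have := ti_lt (p - a)
  have := ti_lt (b - a)
  have := ti_lt (q - a)
  grind

theorem left_mem_cArc (a b : 𝕊) : a ∈ closedArc a b := by
  simp only [closedArc, Set.mem_ofPred_eq, sub_self, ti_zero]; exact ti_nonneg _

theorem right_mem_cArc (a b : 𝕊) : b ∈ closedArc a b := by
  simp [closedArc]

theorem hI_mem (a b x : 𝕊) (h : hI a b x ≠ 0) : x ∈ closedArc a b := by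
  simp only [hI] at h
  simp only [closedArc, Set.mem_ofPred_eq]
  grind

/-! ### Transposition -/

namespace RectDiagram

/-- Swap the two circle factors and the two signs. -/
def tr (R : RectDiagram) : RectDiagram where
  pos := R.neg.map (Equiv.prodComm 𝕊 𝕊).toEmbedding
  neg := R.pos.map (Equiv.prodComm 𝕊 𝕊).toEmbedding
  disj := by
    rw [Finset.disjoint_map]; exact R.disj.symm
  nonempty := by
    rw [← Finset.map_union, Finset.map_nonempty, Finset.union_comm]; exact R.nonempty
  thetaEq := by
    have := R.phiEq
    ext x
    have := congrArg (x ∈ ·) this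
    simp at this ⊢
    exact this.symm
  phiEq := by
    have := R.thetaEq
    ext x
    have := congrArg (x ∈ ·) this
    simp at this ⊢
    exact this.symm
  thetaInjPos := by
    rintro ⟨a, b⟩ h ⟨c, d⟩ h' e
    simp at h h' e
    have := R.phiInjNeg h h' e
    simp_all
  thetaInjNeg := by
    rintro ⟨a, b⟩ h ⟨c, d⟩ h' e
    simp at h h' e
    have := R.phiInjPos h h' e
    simp_all
  phiInjPos := by
    rintro ⟨a, b⟩ h ⟨c, d⟩ h' e
    simp at h h' e
    have := R.thetaInjNeg h h' e
    simp_all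
  phiInjNeg := by
    rintro ⟨a, b⟩ h ⟨c, d⟩ h' e
    simp at h h' e
    have := R.thetaInjPos h h' e
    simp_all

theorem mem_tr_pos (R : RectDiagram) (x y : 𝕊) : (x, y) ∈ R.tr.pos ↔ (y, x) ∈ R.neg := by
  simp [tr]

theorem mem_tr_neg (R : RectDiagram) (x y : 𝕊) : (x, y) ∈ R.tr.neg ↔ (y, x) ∈ R.pos := by
  simp [tr]

theorem mem_verts (R : RectDiagram) (v : Torus) : v ∈ R.verts ↔ v ∈ R.pos ∨ v ∈ R.neg := by
  simp [verts]

theorem mem_tr_verts (R : RectDiagram) (x y : 𝕊) : (x, y) ∈ R.tr.verts ↔ (y, x) ∈ R.verts := by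
  rw [mem_verts, mem_verts, mem_tr_pos, mem_tr_neg, or_comm]

theorem mem_pθ (R : RectDiagram) (x : 𝕊) : x ∈ R.pθ ↔ ∃ y, (x, y) ∈ R.verts := by
  simp [pθ]

theorem mem_pφ (R : RectDiagram) (y : 𝕊) : y ∈ R.pφ ↔ ∃ x, (x, y) ∈ R.verts := by
  simp [pφ]

theorem tr_pθ (R : RectDiagram) : R.tr.pθ = R.pφ := by
  ext x; simp only [mem_pθ, mem_pφ, mem_tr_verts]

theorem tr_pφ (R : RectDiagram) : R.tr.pφ = R.pθ := by
  ext x; simp only [mem_pθ, mem_pφ, mem_tr_verts]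

theorem col_pos_neg (R : RectDiagram) {x y : 𝕊} (h : (x, y) ∈ R.pos) : ∃ z, (x, z) ∈ R.neg := by
  have := congrArg (x ∈ ·) R.thetaEq
  simp at this
  exact this.1 ⟨y, h⟩

theorem col_neg_pos (R : RectDiagram) {x y : 𝕊} (h : (x, y) ∈ R.neg) : ∃ z, (x, z) ∈ R.pos := by
  have := congrArg (x ∈ ·) R.thetaEq
  simp at this
  exact this.2 ⟨y, h⟩

theorem row_pos_neg (R : RectDiagram) {x y : 𝕊} (h : (x, y) ∈ R.pos) : ∃ z, (z, y) ∈ R.neg := by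
  have := congrArg (y ∈ ·) R.phiEq
  simp at this
  exact this.1 ⟨x, h⟩

theorem row_neg_pos (R : RectDiagram) {x y : 𝕊} (h : (x, y) ∈ R.neg) : ∃ z, (z, y) ∈ R.pos := by
  have := congrArg (y ∈ ·) R.phiEq
  simp at this
  exact this.2 ⟨x, h⟩

theorem pos_col (R : RectDiagram) {x y z : 𝕊} (h : (x, y) ∈ R.pos) (h' : (x, z) ∈ R.pos) :
    y = z := congrArg Prod.snd (R.thetaInjPos h h' rfl)

theorem neg_col (R : RectDiagram) {x y z : 𝕊} (h : (x, y) ∈ R.neg) (h' : (x, z) ∈ R.neg) :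
    y = z := congrArg Prod.snd (R.thetaInjNeg h h' rfl)

theorem pos_row (R : RectDiagram) {x y z : 𝕊} (h : (x, z) ∈ R.pos) (h' : (y, z) ∈ R.pos) :
    x = y := congrArg Prod.fst (R.phiInjPos h h' rfl)

theorem neg_row (R : RectDiagram) {x y z : 𝕊} (h : (x, z) ∈ R.neg) (h' : (y, z) ∈ R.neg) :
    x = y := congrArg Prod.fst (R.phiInjNeg h h' rfl)

theorem not_both (R : RectDiagram) {v : Torus} (h : v ∈ R.pos) (h' : v ∈ R.neg) : False :=
  Finset.disjoint_left.1 R.disj h h'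

open Classical in
/-- Indicator that `(θ,φ)` lies on the half-open vertical segment at `θ`. -/
def F (R : RectDiagram) (θ φ : 𝕊) : ℤ :=
  if ∃ a b, (θ, a) ∈ R.pos ∧ (θ, b) ∈ R.neg ∧ hI a b φ = 1 then 1 else 0

/-- Indicator that `(θ,φ)` lies on the half-open horizontal segment at `φ`. -/
def G (R : RectDiagram) (θ φ : 𝕊) : ℤ := R.tr.F φ θ

theorem hI_01 (a b x : 𝕊) : hI a b x = 0 ∨ hI a b x = 1 := by
  simp only [hI]; grind

theorem F_eq (R : RectDiagram) {θ a b : 𝕊} (ha : (θ, a) ∈ R.pos) (hb : (θ, b) ∈ R.neg) (φ : 𝕊) :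
    R.F θ φ = hI a b φ := by
  unfold F
  split_ifs with h
  · obtain ⟨a', b', ha', hb', h⟩ := h
    rw [R.pos_col ha ha', R.neg_col hb hb', h]
  · rcases hI_01 a b φ with h' | h'
    · exact h'.symm
    · exact (h ⟨a, b, ha, hb, h'⟩).elim

theorem F_zero (R : RectDiagram) {θ : 𝕊} (h : ∀ a, (θ, a) ∉ R.pos) (φ : 𝕊) : R.F θ φ = 0 := by
  unfold F
  rw [if_neg]
  rintro ⟨a, b, ha, -⟩
  exact h a ha

theorem G_eq (R : RectDiagram) {φ a b : 𝕊} (ha : (a, φ) ∈ R.neg) (hb : (b, φ) ∈ R.pos) (θ : 𝕊) :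
    R.G θ φ = hI a b θ :=
  R.tr.F_eq ((R.mem_tr_pos _ _).2 ha) ((R.mem_tr_neg _ _).2 hb) θ

theorem G_zero (R : RectDiagram) {φ : 𝕊} (h : ∀ a, (a, φ) ∉ R.neg) (θ : 𝕊) : R.G θ φ = 0 :=
  R.tr.F_zero (fun a ha => h a ((R.mem_tr_pos _ _).1 ha)) θ

theorem F_01 (R : RectDiagram) (θ φ : 𝕊) : R.F θ φ = 0 ∨ R.F θ φ = 1 := by
  unfold F; split_ifs <;> simp

theorem G_01 (R : RectDiagram) (θ φ : 𝕊) : R.G θ φ = 0 ∨ R.G θ φ = 1 := R.tr.F_01 _ _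

theorem F_ne (R : RectDiagram) {θ φ : 𝕊} (h : R.F θ φ ≠ 0) : θ ∈ R.pθ := by
  by_contra h'
  refine h (R.F_zero (fun a ha => h' ?_) φ)
  exact (R.mem_pθ _).2 ⟨a, (R.mem_verts _).2 (Or.inl ha)⟩

theorem G_ne (R : RectDiagram) {θ φ : 𝕊} (h : R.G θ φ ≠ 0) : φ ∈ R.pφ := by
  rw [← R.tr_pθ]; exact R.tr.F_ne h

theorem F_one (R : RectDiagram) {θ φ : 𝕊} :
    R.F θ φ = 1 ↔ ∃ a b, (θ, a) ∈ R.pos ∧ (θ, b) ∈ R.neg ∧ hI a b φ = 1 := by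
  unfold F
  split_ifs with h
  · exact ⟨fun _ => h, fun _ => rfl⟩
  · exact ⟨fun h' => by simp at h', fun h' => (h h').elim⟩

theorem G_one (R : RectDiagram) {θ φ : 𝕊} :
    R.G θ φ = 1 ↔ ∃ a b, (a, φ) ∈ R.neg ∧ (b, φ) ∈ R.pos ∧ hI a b θ = 1 := by
  simp only [G, F_one, mem_tr_pos, mem_tr_neg]

end RectDiagram

theorem hI_one (a b x : 𝕊) : hI a b x = 1 ↔ toIco (x - a) < toIco (b - a) := by
  simp only [hI]; split_ifs <;> simp_all

theorem openArc_iff (a b x : 𝕊) : x ∈ openArc a b ↔ hI a b x = 1 ∧ x ≠ a := by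
  rw [hI_one]
  constructor
  · rintro ⟨h1, h2⟩
    refine ⟨h2, ?_⟩
    rintro rfl
    rw [sub_self, ti_zero] at h1
    exact lt_irrefl _ h1
  · rintro ⟨h1, h2⟩
    refine ⟨lt_of_le_of_ne (ti_nonneg _) fun h => h2 ?_, h1⟩
    exact sub_eq_zero.1 (ti_eq_zero h.symm)

theorem closedArc_iff (a b x : 𝕊) (h : x ≠ b) : x ∈ closedArc a b ↔ hI a b x = 1 := by
  rw [hI_one]
  constructor
  · intro h1
    exact lt_of_le_of_ne h1 fun h' => h (ti_inj a h')
  · exact fun h => le_of_lt h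

namespace RectDiagram

theorem mem_doublePts (R : RectDiagram) (p : Torus) :
    p ∈ DoublePts R ↔ R.F p.1 p.2 * R.G p.1 p.2 = 1 := by
  obtain ⟨x, y⟩ := p
  have key : R.F x y * R.G x y = 1 ↔ R.F x y = 1 ∧ R.G x y = 1 := by
    rcases R.F_01 x y with h | h <;> rcases R.G_01 x y with h' | h' <;> simp [h, h']
  simp only [key, F_one, G_one, DoublePts, OnVertInt, OnHorizInt, Set.mem_ofPred_eq, openArc_iff]
  constructor
  · rintro ⟨⟨t, a, b, ha, hb, rfl, h1, h2⟩, ⟨c, d, t', hc, hd, rfl, h3, h4⟩⟩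
    exact ⟨⟨a, b, ha, hb, h1⟩, ⟨c, d, hc, hd, h3⟩⟩
  · rintro ⟨⟨a, b, ha, hb, h1⟩, ⟨c, d, hc, hd, h3⟩⟩
    refine ⟨⟨x, a, b, ha, hb, rfl, h1, ?_⟩, ⟨c, d, y, hc, hd, rfl, h3, ?_⟩⟩
    · rintro rfl
      have := R.pos_row ha hd
      subst this
      rw [hI_right] at h3
      simp at h3
    · rintro rfl
      have := R.neg_col hb hc
      subst this
      rw [hI_right] at h1
      simp at h1

theorem D_eq (R : RectDiagram) (S T : Finset 𝕊) (hS : R.pθ ⊆ S) (hT : R.pφ ⊆ T) :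
    ((DoublePts R).ncard : ℤ) = ∑ θ ∈ S, ∑ φ ∈ T, R.F θ φ * R.G θ φ := by
  classical
  have e : DoublePts R = ↑((S ×ˢ T).filter fun p : Torus => R.F p.1 p.2 * R.G p.1 p.2 = 1) := by
    ext p
    rw [mem_doublePts]
    simp only [Finset.coe_filter, Finset.mem_product, Set.mem_ofPred_eq]
    refine ⟨fun h => ⟨⟨hS (R.F_ne (φ := p.2) ?_), hT (R.G_ne (θ := p.1) ?_)⟩, h⟩, fun h => h.2⟩
    · intro h0; simp [h0] at h
    · intro h0; simp [h0] at h
  rw [e, Set.ncard_coe_finset, Finset.card_filter, ← Finset.sum_product']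
  push_cast
  refine Finset.sum_congr rfl fun p _ => ?_
  rcases R.F_01 p.1 p.2 with h | h <;> rcases R.G_01 p.1 p.2 with h' | h' <;> simp [h, h']

def L (R : RectDiagram) : ℤ := ∑ θ ∈ R.pθ, R.F θ 0

theorem sum_F_sub (R : RectDiagram) (S : Finset 𝕊) (hS : R.pθ ⊆ S) (φ : 𝕊) :
    ∑ θ ∈ S, R.F θ φ = ∑ θ ∈ R.pθ, R.F θ φ := by
  symm
  refine Finset.sum_subset hS fun x _ hx => ?_
  by_contra h
  exact hx (R.F_ne h)

theorem pθ_pos (R : RectDiagram) : R.pθ = R.pos.image Prod.fst := by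
  rw [pθ, verts, Finset.image_union, ← R.thetaEq, Finset.union_self]

theorem sum_F_const (R : RectDiagram) (φ φ' : 𝕊) :
    ∑ θ ∈ R.pθ, R.F θ φ = ∑ θ ∈ R.pθ, R.F θ φ' := by
  have hp : ∀ θ : 𝕊, ∃ a, θ ∈ R.pθ → (θ, a) ∈ R.pos := by
    intro θ
    by_cases h : θ ∈ R.pθ
    · rw [pθ_pos] at h
      simp at h
      exact h.imp fun a ha _ => ha
    · exact ⟨0, fun h' => (h h').elim⟩
  have hn : ∀ θ : 𝕊, ∃ a, θ ∈ R.pθ → (θ, a) ∈ R.neg := by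
    intro θ
    by_cases h : θ ∈ R.pθ
    · rw [pθ_pos, R.thetaEq] at h
      simp at h
      exact h.imp fun a ha _ => ha
    · exact ⟨0, fun h' => (h h').elim⟩
  choose p hp using hp
  choose n hn using hn
  have e1 : ∀ f : 𝕊 → ℝ, ∑ θ ∈ R.pθ, f (p θ) = ∑ y ∈ R.pos.image Prod.snd, f y := by
    intro f
    rw [Finset.sum_image R.phiInjPos, pθ_pos, Finset.sum_image R.thetaInjPos]
    refine Finset.sum_congr rfl fun v hv => ?_
    have : v.1 ∈ R.pθ := by rw [pθ_pos]; exact Finset.mem_image_of_mem _ hv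
    rw [R.pos_col (hp _ this) (z := v.2) hv]
  have e2 : ∀ f : 𝕊 → ℝ, ∑ θ ∈ R.pθ, f (n θ) = ∑ y ∈ R.pos.image Prod.snd, f y := by
    intro f
    rw [R.phiEq, Finset.sum_image R.phiInjNeg, pθ_pos, R.thetaEq, Finset.sum_image R.thetaInjNeg]
    refine Finset.sum_congr rfl fun v hv => ?_
    have : v.1 ∈ R.pθ := by rw [pθ_pos, R.thetaEq]; exact Finset.mem_image_of_mem _ hv
    rw [R.neg_col (hn _ this) (z := v.2) hv]
  have key : ∀ φ : 𝕊, ((∑ θ ∈ R.pθ, R.F θ φ : ℤ) : ℝ) = ∑ θ ∈ R.pθ, toIco (n θ - p θ) := by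
    intro φ
    push_cast
    have : ∀ θ ∈ R.pθ, (R.F θ φ : ℝ) =
        toIco (n θ - p θ) - toIco (φ - p θ) + toIco (φ - n θ) := by
      intro θ hθ
      rw [R.F_eq (hp θ hθ) (hn θ hθ), hI_real]
      intro h
      exact R.not_both (hp θ hθ) (h ▸ hn θ hθ)
    rw [Finset.sum_congr rfl this, Finset.sum_add_distrib, Finset.sum_sub_distrib,
      e1 (fun y => toIco (φ - y)), e2 (fun y => toIco (φ - y))]
    ring
  have := (key φ).trans (key φ').symm
  exact_mod_cast this

theorem L_eq (R : RectDiagram) (S : Finset 𝕊) (hS : R.pθ ⊆ S) (φ : 𝕊) :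
    ∑ θ ∈ S, R.F θ φ = R.L := by
  rw [R.sum_F_sub S hS, L, R.sum_F_const φ 0]

theorem K_eq (R : RectDiagram) (T : Finset 𝕊) (hT : R.pφ ⊆ T) (θ : 𝕊) :
    ∑ φ ∈ T, R.G θ φ = R.tr.L := R.tr.L_eq T (by rw [tr_pθ]; exact hT) θ

theorem lonCount_eq (R : RectDiagram) (φ : 𝕊) (h : φ ∉ R.pφ) :
    (lonCount (Gamma R) φ : ℤ) = R.L := by
  classical
  have e : Gamma R ∩ {p | p.2 = φ} =
      ↑((R.pθ.filter fun θ => R.F θ φ = 1).map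
        ⟨fun θ => (θ, φ), fun a b h => congrArg Prod.fst h⟩) := by
    ext ⟨x, y⟩
    simp only [Gamma, Set.mem_inter_iff, Set.mem_union, Set.mem_ofPred_eq, Finset.coe_map,
      Set.mem_image, Finset.coe_filter]
    constructor
    · rintro ⟨h1 | h1, rfl⟩
      · obtain ⟨t, a, b, ha, hb, rfl, h1⟩ := h1
        have hyb : y ≠ b := by
          rintro rfl
          exact h ((R.mem_pφ _).2 ⟨_, (R.mem_verts _).2 (Or.inr hb)⟩)
        refine ⟨x, ⟨(R.mem_pθ _).2 ⟨_, (R.mem_verts _).2 (Or.inr hb)⟩, ?_⟩, rfl⟩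
        rw [R.F_eq ha hb]
        exact (closedArc_iff _ _ _ hyb).1 h1
      · obtain ⟨t, a, b, ha, hb, rfl, h1⟩ := h1
        exact (h ((R.mem_pφ _).2 ⟨_, (R.mem_verts _).2 (Or.inr ha)⟩)).elim
    · rintro ⟨x', ⟨hx, h1⟩, h2⟩
      obtain ⟨rfl, rfl⟩ := Prod.mk.inj h2
      obtain ⟨a, b, ha, hb, h1⟩ := R.F_one.1 h1
      refine ⟨Or.inl ⟨x', a, b, ha, hb, rfl, ?_⟩, rfl⟩
      simp only [hI_one] at h1
      exact le_of_lt h1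
  rw [lonCount, e, Set.ncard_coe_finset, Finset.card_map, Finset.card_filter,
    ← R.L_eq R.pθ (Finset.Subset.refl _) φ]
  push_cast
  refine Finset.sum_congr rfl fun p _ => ?_
  rcases R.F_01 p φ with h | h <;> simp [h]

theorem gamma_tr (R : RectDiagram) (x y : 𝕊) : (x, y) ∈ Gamma R.tr ↔ (y, x) ∈ Gamma R := by
  simp only [Gamma, Set.mem_union, Set.mem_ofPred_eq, mem_tr_pos, mem_tr_neg]
  rw [or_comm]
  constructor
  · rintro (⟨a, b, c, h1, h2, h3, h4⟩ | ⟨a, b, c, h1, h2, h3, h4⟩)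
    · exact Or.inl ⟨c, a, b, h1, h2, h3, h4⟩
    · exact Or.inr ⟨b, c, a, h1, h2, h3, h4⟩
  · rintro (⟨a, b, c, h1, h2, h3, h4⟩ | ⟨a, b, c, h1, h2, h3, h4⟩)
    · exact Or.inl ⟨b, c, a, h1, h2, h3, h4⟩
    · exact Or.inr ⟨c, a, b, h1, h2, h3, h4⟩

theorem merCount_tr (R : RectDiagram) (θ : 𝕊) :
    merCount (Gamma R) θ = lonCount (Gamma R.tr) θ := by
  have : Gamma R ∩ {p | p.1 = θ} = Prod.swap '' (Gamma R.tr ∩ {p | p.2 = θ}) := by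
    ext ⟨x, y⟩
    rw [Set.image_swap_eq_preimage_swap]
    simp [gamma_tr]
  rw [merCount, lonCount, this, Set.ncard_image_of_injective _ Prod.swap_injective]

theorem exists_notMem (S : Finset 𝕊) : ∃ x, x ∉ S := by
  have : Infinite 𝕊 := by
    have := (AddCircle.equivIco (1 : ℝ) 0).infinite_iff
    rw [this]
    exact (Set.Ico_infinite (by norm_num)).to_subtype
  exact Infinite.exists_notMem_finset S

theorem isHomClass_iff (R : RectDiagram) (k l : ℕ) :
    IsHomClass R k l ↔ R.tr.L = k ∧ R.L = l := by
  have e1 : ∀ θ, θ ∉ R.pθ → (merCount (Gamma R) θ : ℤ) = R.tr.L := by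
    intro θ h
    rw [merCount_tr]
    exact R.tr.lonCount_eq θ (by rwa [tr_pφ])
  constructor
  · rintro ⟨h1, h2⟩
    obtain ⟨x, hx⟩ := exists_notMem R.pθ
    obtain ⟨y, hy⟩ := exists_notMem R.pφ
    rw [← e1 x hx, ← R.lonCount_eq y hy, h1 x hx, h2 y hy]
    exact ⟨rfl, rfl⟩
  · rintro ⟨h1, h2⟩
    refine ⟨fun x hx => ?_, fun y hy => ?_⟩
    · have := e1 x hx
      rw [h1] at this; exact_mod_cast this
    · have := R.lonCount_eq y hy
      rw [h2] at this; exact_mod_cast this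

theorem tr_tr (R : RectDiagram) : R.tr.tr = R := by
  cases R
  simp only [tr, Finset.map_map, RectDiagram.mk.injEq]
  constructor <;> (ext ⟨x, y⟩; simp)

theorem D_tr (R : RectDiagram) : (DoublePts R.tr).ncard = (DoublePts R).ncard := by
  have : DoublePts R = Prod.swap '' (DoublePts R.tr) := by
    ext ⟨x, y⟩
    rw [Set.image_swap_eq_preimage_swap]
    simp only [Set.mem_preimage, mem_doublePts, G, tr_tr, Prod.swap]
    rw [mul_comm]
  rw [this, Set.ncard_image_of_injective _ Prod.swap_injective]

end RectDiagram

/-! ### The summation lemma -/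

theorem sum_move (F₁ G₁ F₂ G₂ : 𝕊 → 𝕊 → ℤ) (S T : Finset 𝕊) (θ₁ θ₂ φ₁ φ₂ : 𝕊)
    (e d : 𝕊 → ℤ) (a ε : ℤ) (hε : ε * ε = 1)
    (hθ : θ₁ ≠ θ₂) (hφ : φ₁ ≠ φ₂)
    (h1 : θ₁ ∈ S) (h2 : θ₂ ∈ S) (h3 : φ₁ ∈ T) (h4 : φ₂ ∈ T)
    (he1 : e φ₁ = 1) (he2 : e φ₂ = 0) (hd1 : d θ₁ = 1) (hd2 : d θ₂ = 0)
    (hF : ∀ θ φ, F₂ θ φ = F₁ θ φ + ε * ((if θ = θ₁ then 1 else 0) - (if θ = θ₂ then 1 else 0)) * e φ)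
    (hG : ∀ θ φ, G₂ θ φ = G₁ θ φ +
      ((if φ = φ₂ then 1 else 0) - (if φ = φ₁ then 1 else 0)) * (a + ε * d θ))
    (cF : ∀ θ, d θ ≠ 0 → θ ≠ θ₁ → F₁ θ φ₁ = F₁ θ φ₂)
    (cG : ∀ φ, e φ ≠ 0 → φ ≠ φ₁ → G₁ θ₁ φ = G₁ θ₂ φ)
    (hc : ∑ θ ∈ S, F₁ θ φ₁ = ∑ θ ∈ S, F₁ θ φ₂)
    (hl : ε * (F₁ θ₁ φ₂ - F₁ θ₁ φ₁ + G₁ θ₁ φ₁ - G₁ θ₂ φ₁) = 1) :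
    ∑ θ ∈ S, ∑ φ ∈ T, F₂ θ φ * G₂ θ φ = ∑ θ ∈ S, ∑ φ ∈ T, F₁ θ φ * G₁ θ φ := by
  have A : ∑ θ ∈ S, ∑ φ ∈ T, F₁ θ φ * ((if φ = φ₂ then 1 else 0) - (if φ = φ₁ then 1 else 0)) *
      (a + ε * d θ) = ε * (F₁ θ₁ φ₂ - F₁ θ₁ φ₁) := by
    have : ∀ θ ∈ S, ∑ φ ∈ T, F₁ θ φ * ((if φ = φ₂ then 1 else 0) - (if φ = φ₁ then 1 else 0)) *
      (a + ε * d θ) = a * F₁ θ φ₂ - a * F₁ θ φ₁ +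
        if θ = θ₁ then ε * (F₁ θ₁ φ₂ - F₁ θ₁ φ₁) else 0 := by
      intro θ _
      rw [← Finset.sum_mul]
      simp only [mul_sub, Finset.sum_sub_distrib, mul_ite, mul_one, mul_zero, Finset.sum_ite_eq',
        h3, h4, if_true]
      split_ifs with h
      · subst h; rw [hd1]; ring
      · by_cases h0 : d θ = 0
        · rw [h0]; ring
        · rw [cF θ h0 h]; ring
    rw [Finset.sum_congr rfl this, Finset.sum_add_distrib, Finset.sum_sub_distrib,
      ← Finset.mul_sum, ← Finset.mul_sum, hc]
    simp [h1]
  have B : ∑ θ ∈ S, ∑ φ ∈ T, (ε * ((if θ = θ₁ then 1 else 0) - (if θ = θ₂ then 1 else 0)) * e φ) *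
      G₁ θ φ = ε * (G₁ θ₁ φ₁ - G₁ θ₂ φ₁) := by
    rw [Finset.sum_comm]
    have : ∀ φ ∈ T, ∑ θ ∈ S, (ε * ((if θ = θ₁ then 1 else 0) - (if θ = θ₂ then 1 else 0)) * e φ) *
      G₁ θ φ = if φ = φ₁ then ε * (G₁ θ₁ φ₁ - G₁ θ₂ φ₁) else 0 := by
      intro φ _
      have : ∀ θ ∈ S, (ε * ((if θ = θ₁ then 1 else 0) - (if θ = θ₂ then 1 else 0)) * e φ) *
          G₁ θ φ = (if θ = θ₁ then ε * e φ * G₁ θ φ else 0) -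
            (if θ = θ₂ then ε * e φ * G₁ θ φ else 0) := by
        intro θ _; split_ifs <;> ring
      rw [Finset.sum_congr rfl this, Finset.sum_sub_distrib, Finset.sum_ite_eq',
        Finset.sum_ite_eq', if_pos h1, if_pos h2]
      split_ifs with h
      · subst h; rw [he1]; ring
      · by_cases h0 : e φ = 0
        · rw [h0]; ring
        · rw [cG φ h0 h]; ring
    rw [Finset.sum_congr rfl this]
    simp [h3]
  have C : ∑ θ ∈ S, ∑ φ ∈ T, (ε * ((if θ = θ₁ then 1 else 0) - (if θ = θ₂ then 1 else 0)) * e φ) *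
      (((if φ = φ₂ then 1 else 0) - (if φ = φ₁ then 1 else 0)) * (a + ε * d θ)) = -1 := by
    have : ∀ θ ∈ S, ∑ φ ∈ T, (ε * ((if θ = θ₁ then 1 else 0) - (if θ = θ₂ then 1 else 0)) * e φ) *
      (((if φ = φ₂ then 1 else 0) - (if φ = φ₁ then 1 else 0)) * (a + ε * d θ)) =
      (if θ = θ₁ then - ε * (a + ε * d θ) else 0) - (if θ = θ₂ then - ε * (a + ε * d θ) else 0) := by
      intro θ _
      have : ∀ φ ∈ T, (ε * ((if θ = θ₁ then 1 else 0) - (if θ = θ₂ then 1 else 0)) * e φ) *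
        (((if φ = φ₂ then 1 else 0) - (if φ = φ₁ then 1 else 0)) * (a + ε * d θ)) =
        if φ = φ₁ then (ε * ((if θ = θ₁ then 1 else 0) - (if θ = θ₂ then 1 else 0))) *
          (-(a + ε * d θ)) else 0 := by
        intro φ _
        by_cases ha : φ = φ₁
        · subst ha; simp only [he1, if_neg hφ, if_true]; ring
        · by_cases hb : φ = φ₂
          · subst hb; simp only [he2, if_neg ha]; ring
          · simp only [if_neg ha, if_neg hb]; ring
      rw [Finset.sum_congr rfl this, Finset.sum_ite_eq', if_pos h3]
      split_ifs <;> ring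
    rw [Finset.sum_congr rfl this, Finset.sum_sub_distrib, Finset.sum_ite_eq',
        Finset.sum_ite_eq', if_pos h1, if_pos h2, hd1, hd2]
    linear_combination (-1) * hε
  have E : ∀ θ ∈ S, ∑ φ ∈ T, F₂ θ φ * G₂ θ φ = ∑ φ ∈ T, F₁ θ φ * G₁ θ φ +
     ∑ φ ∈ T, F₁ θ φ * ((if φ = φ₂ then 1 else 0) - (if φ = φ₁ then 1 else 0)) *
      (a + ε * d θ) +
     ∑ φ ∈ T, (ε * ((if θ = θ₁ then 1 else 0) - (if θ = θ₂ then 1 else 0)) * e φ) * G₁ θ φ +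
     ∑ φ ∈ T, (ε * ((if θ = θ₁ then 1 else 0) - (if θ = θ₂ then 1 else 0)) * e φ) *
      (((if φ = φ₂ then 1 else 0) - (if φ = φ₁ then 1 else 0)) * (a + ε * d θ)) := by
    intro θ _
    rw [← Finset.sum_add_distrib, ← Finset.sum_add_distrib, ← Finset.sum_add_distrib]
    refine Finset.sum_congr rfl fun φ _ => ?_
    rw [hF, hG]; ring
  rw [Finset.sum_congr rfl E, Finset.sum_add_distrib, Finset.sum_add_distrib,
    Finset.sum_add_distrib, A, B, C]
  linarith

/-! ### Moves -/

/-- Symmetric form of the data of an elementary move. -/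
structure Mv (R₁ R₂ : RectDiagram) (θ₁ θ₂ φ₁ φ₂ : 𝕊) : Prop where
  hθ : θ₁ ≠ θ₂
  hφ : φ₁ ≠ φ₂
  hpos : ∀ x y, ¬ ((x = θ₁ ∨ x = θ₂) ∧ (y = φ₁ ∨ y = φ₂)) → ((x, y) ∈ R₁.pos ↔ (x, y) ∈ R₂.pos)
  hneg : ∀ x y, ¬ ((x = θ₁ ∨ x = θ₂) ∧ (y = φ₁ ∨ y = φ₂)) → ((x, y) ∈ R₁.neg ↔ (x, y) ∈ R₂.neg)
  hrect : ∀ x y, ((x, y) ∈ R₁.verts ∨ (x, y) ∈ R₂.verts) →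
    ¬ ((x = θ₁ ∨ x = θ₂) ∧ (y = φ₁ ∨ y = φ₂)) → x ∈ closedArc θ₁ θ₂ → y ∉ closedArc φ₁ φ₂
  hcor : ∀ x y, (x = θ₁ ∨ x = θ₂) → (y = φ₁ ∨ y = φ₂) → ((x, y) ∈ R₁.verts ↔ (x, y) ∉ R₂.verts)

theorem Mv.symm {R₁ R₂ : RectDiagram} {θ₁ θ₂ φ₁ φ₂ : 𝕊} (M : Mv R₁ R₂ θ₁ θ₂ φ₁ φ₂) :
    Mv R₂ R₁ θ₁ θ₂ φ₁ φ₂ where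
  hθ := M.hθ
  hφ := M.hφ
  hpos x y h := (M.hpos x y h).symm
  hneg x y h := (M.hneg x y h).symm
  hrect x y h := M.hrect x y h.symm
  hcor x y h h' := by have := M.hcor x y h h'; tauto

theorem Mv.tr {R₁ R₂ : RectDiagram} {θ₁ θ₂ φ₁ φ₂ : 𝕊} (M : Mv R₁ R₂ θ₁ θ₂ φ₁ φ₂) :
    Mv R₁.tr R₂.tr φ₁ φ₂ θ₁ θ₂ where
  hθ := M.hφ
  hφ := M.hθ
  hpos x y h := by
    rw [RectDiagram.mem_tr_pos, RectDiagram.mem_tr_pos]; exact M.hneg y x (by tauto)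
  hneg x y h := by
    rw [RectDiagram.mem_tr_neg, RectDiagram.mem_tr_neg]; exact M.hpos y x (by tauto)
  hrect x y h h' := by
    rw [RectDiagram.mem_tr_verts, RectDiagram.mem_tr_verts] at h
    have := M.hrect y x h (by tauto)
    tauto
  hcor x y h h' := by
    rw [RectDiagram.mem_tr_verts, RectDiagram.mem_tr_verts]; exact M.hcor y x h' h

def SameInv (R₁ R₂ : RectDiagram) : Prop :=
  (DoublePts R₁).ncard = (DoublePts R₂).ncard ∧ R₁.tr.L = R₂.tr.L ∧ R₁.L = R₂.L

theorem SameInv.symm {R₁ R₂ : RectDiagram} (h : SameInv R₁ R₂) : SameInv R₂ R₁ :=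
  ⟨h.1.symm, h.2.1.symm, h.2.2.symm⟩

theorem SameInv.of_tr {R₁ R₂ : RectDiagram} (h : SameInv R₁.tr R₂.tr) : SameInv R₁ R₂ := by
  obtain ⟨h1, h2, h3⟩ := h
  rw [RectDiagram.tr_tr, RectDiagram.tr_tr] at h2
  rw [RectDiagram.D_tr, RectDiagram.D_tr] at h1
  exact ⟨h1, h3, h2⟩

namespace Mv

variable {R₁ R₂ : RectDiagram} {θ₁ θ₂ φ₁ φ₂ : 𝕊}

theorem F_off (M : Mv R₁ R₂ θ₁ θ₂ φ₁ φ₂) {θ : 𝕊} (h1 : θ ≠ θ₁) (h2 : θ ≠ θ₂) (φ : 𝕊) :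
    R₂.F θ φ = R₁.F θ φ := by
  have e1 := fun y => M.hpos θ y (by tauto)
  have e2 := fun y => M.hneg θ y (by tauto)
  have : R₂.F θ φ = 1 ↔ R₁.F θ φ = 1 := by
    rw [RectDiagram.F_one, RectDiagram.F_one]
    exact exists_congr fun a => exists_congr fun b => by rw [e1, e2]
  rcases R₁.F_01 θ φ with h | h <;> rcases R₂.F_01 θ φ with h' | h' <;> simp_all

theorem G_off (M : Mv R₁ R₂ θ₁ θ₂ φ₁ φ₂) {φ : 𝕊} (h1 : φ ≠ φ₁) (h2 : φ ≠ φ₂) (θ : 𝕊) :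
    R₂.G θ φ = R₁.G θ φ := M.tr.F_off h1 h2 θ

theorem cF (M : Mv R₁ R₂ θ₁ θ₂ φ₁ φ₂) (θ : 𝕊) (h : hI θ₁ θ₂ θ ≠ 0) (h' : θ ≠ θ₁) :
    R₁.F θ φ₁ = R₁.F θ φ₂ := by
  have h2 : θ ≠ θ₂ := by
    rintro rfl; exact h (hI_right _ _)
  by_cases hp : ∃ a, (θ, a) ∈ R₁.pos
  · obtain ⟨a, ha⟩ := hp
    obtain ⟨b, hb⟩ := R₁.col_pos_neg ha
    rw [R₁.F_eq ha hb, R₁.F_eq ha hb]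
    apply hI_const
    · exact M.hrect θ a (Or.inl ((R₁.mem_verts _).2 (Or.inl ha))) (by tauto) (hI_mem _ _ _ h)
    · exact M.hrect θ b (Or.inl ((R₁.mem_verts _).2 (Or.inr hb))) (by tauto) (hI_mem _ _ _ h)
  · push Not at hp
    rw [R₁.F_zero hp, R₁.F_zero hp]

theorem cG (M : Mv R₁ R₂ θ₁ θ₂ φ₁ φ₂) (φ : 𝕊) (h : hI φ₁ φ₂ φ ≠ 0) (h' : φ ≠ φ₁) :
    R₁.G θ₁ φ = R₁.G θ₂ φ := M.tr.cF φ h h'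

theorem finish (M : Mv R₁ R₂ θ₁ θ₂ φ₁ φ₂) (a ε : ℤ) (hε : ε * ε = 1)
    (f1 : ∀ φ, R₂.F θ₁ φ = R₁.F θ₁ φ + ε * hI φ₁ φ₂ φ)
    (f2 : ∀ φ, R₂.F θ₂ φ = R₁.F θ₂ φ - ε * hI φ₁ φ₂ φ)
    (g1 : ∀ θ, R₂.G θ φ₁ = R₁.G θ φ₁ - (a + ε * hI θ₁ θ₂ θ))
    (g2 : ∀ θ, R₂.G θ φ₂ = R₁.G θ φ₂ + (a + ε * hI θ₁ θ₂ θ))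
    (hl : ε * (R₁.F θ₁ φ₂ - R₁.F θ₁ φ₁ + R₁.G θ₁ φ₁ - R₁.G θ₂ φ₁) = 1) : SameInv R₁ R₂ := by
  classical
  let S : Finset 𝕊 := insert θ₁ (insert θ₂ (R₁.pθ ∪ R₂.pθ))
  let T : Finset 𝕊 := insert φ₁ (insert φ₂ (R₁.pφ ∪ R₂.pφ))
  have s1 : R₁.pθ ⊆ S := fun x hx => by simp [S, hx]
  have s2 : R₂.pθ ⊆ S := fun x hx => by simp [S, hx]
  have t1 : R₁.pφ ⊆ T := fun x hx => by simp [T, hx]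
  have t2 : R₂.pφ ⊆ T := fun x hx => by simp [T, hx]
  have m1 : θ₁ ∈ S := by simp [S]
  have m2 : θ₂ ∈ S := by simp [S]
  have m3 : φ₁ ∈ T := by simp [T]
  have m4 : φ₂ ∈ T := by simp [T]
  have hF : ∀ θ φ, R₂.F θ φ = R₁.F θ φ +
      ε * ((if θ = θ₁ then 1 else 0) - (if θ = θ₂ then 1 else 0)) * hI φ₁ φ₂ φ := by
    intro θ φ
    by_cases h : θ = θ₁
    · rw [h, f1, if_pos rfl, if_neg M.hθ]; ring
    · by_cases h' : θ = θ₂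
      · rw [h', f2, if_pos rfl, if_neg M.hθ.symm]; ring
      · rw [M.F_off h h', if_neg h, if_neg h']; ring
  have hG : ∀ θ φ, R₂.G θ φ = R₁.G θ φ +
      ((if φ = φ₂ then 1 else 0) - (if φ = φ₁ then 1 else 0)) * (a + ε * hI θ₁ θ₂ θ) := by
    intro θ φ
    by_cases h : φ = φ₁
    · rw [h, g1, if_pos rfl, if_neg M.hφ]; ring
    · by_cases h' : φ = φ₂
      · rw [h', g2, if_pos rfl, if_neg M.hφ.symm]; ring
      · rw [M.G_off h h', if_neg h, if_neg h']; ring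
  refine ⟨?_, ?_, ?_⟩
  · have := sum_move R₁.F R₁.G R₂.F R₂.G S T θ₁ θ₂ φ₁ φ₂ (hI φ₁ φ₂) (hI θ₁ θ₂) a ε hε M.hθ M.hφ
      m1 m2 m3 m4 (hI_left _ _ M.hφ) (hI_right _ _) (hI_left _ _ M.hθ) (hI_right _ _) hF hG
      M.cF M.cG (by rw [R₁.L_eq S s1, R₁.L_eq S s1]) hl
    rw [← R₁.D_eq S T s1 t1, ← R₂.D_eq S T s2 t2] at this
    exact_mod_cast this.symm
  · rw [← R₁.K_eq T t1 θ₁, ← R₂.K_eq T t2 θ₁, Finset.sum_congr rfl fun φ _ => hG θ₁ φ,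
      Finset.sum_add_distrib, ← Finset.sum_mul, Finset.sum_sub_distrib, Finset.sum_ite_eq',
      Finset.sum_ite_eq', if_pos m3, if_pos m4]
    ring
  · rw [← R₁.L_eq S s1 φ₁, ← R₂.L_eq S s2 φ₁, Finset.sum_congr rfl fun θ _ => hF θ φ₁,
      Finset.sum_add_distrib, ← Finset.sum_mul, ← Finset.mul_sum, Finset.sum_sub_distrib,
      Finset.sum_ite_eq', Finset.sum_ite_eq', if_pos m1, if_pos m2]
    ring

theorem col_out (M : Mv R₁ R₂ θ₁ θ₂ φ₁ φ₂) {x y : 𝕊} (hv : (x, y) ∈ R₁.pos ∨ (x, y) ∈ R₁.neg)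
    (hx : x = θ₁ ∨ x = θ₂) (h1 : y ≠ φ₁) (h2 : y ≠ φ₂) : y ∉ closedArc φ₁ φ₂ := by
  refine M.hrect x y (Or.inl ((R₁.mem_verts _).2 hv)) (by tauto) ?_
  rcases hx with rfl | rfl
  · exact left_mem_cArc _ _
  · exact right_mem_cArc _ _

theorem row_out (M : Mv R₁ R₂ θ₁ θ₂ φ₁ φ₂) {x y : 𝕊} (hv : (x, y) ∈ R₁.pos ∨ (x, y) ∈ R₁.neg)
    (hy : y = φ₁ ∨ y = φ₂) (h1 : x ≠ θ₁) (h2 : x ≠ θ₂) : x ∉ closedArc θ₁ θ₂ := by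
  refine M.tr.col_out (x := y) (y := x) ?_ hy h1 h2
  rw [RectDiagram.mem_tr_pos, RectDiagram.mem_tr_neg]; exact hv.symm

/-- Exchange moving a horizontal edge. -/
theorem exch (M : Mv R₁ R₂ θ₁ θ₂ φ₁ φ₂) (c1 : (θ₁, φ₁) ∈ R₁.verts) (c2 : (θ₂, φ₁) ∈ R₁.verts)
    (c3 : (θ₂, φ₂) ∉ R₁.verts) (c4 : (θ₁, φ₂) ∉ R₁.verts) : SameInv R₁ R₂ := by
  have hθ := M.hθ
  have hφ := M.hφ
  have d1 : (θ₁, φ₁) ∉ R₂.verts := (M.hcor _ _ (Or.inl rfl) (Or.inl rfl)).1 c1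
  have d2 : (θ₂, φ₁) ∉ R₂.verts := (M.hcor _ _ (Or.inr rfl) (Or.inl rfl)).1 c2
  have d3 : (θ₂, φ₂) ∈ R₂.verts := by
    by_contra h; exact c3 ((M.hcor _ _ (Or.inr rfl) (Or.inr rfl)).2 h)
  have d4 : (θ₁, φ₂) ∈ R₂.verts := by
    by_contra h; exact c4 ((M.hcor _ _ (Or.inl rfl) (Or.inr rfl)).2 h)
  rw [RectDiagram.mem_verts] at c1 c2 c3 c4 d1 d2 d3 d4
  rcases c1 with c1 | c1
  · -- positive at the left end
    have c2 : (θ₂, φ₁) ∈ R₁.neg := c2.resolve_left fun h => hθ (R₁.pos_row c1 h)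
    obtain ⟨q, hq⟩ := R₁.col_pos_neg c1
    obtain ⟨p, hp⟩ := R₁.col_neg_pos c2
    have q1 : q ≠ φ₁ := by rintro rfl; exact R₁.not_both c1 hq
    have q2 : q ≠ φ₂ := by rintro rfl; exact c4 (Or.inr hq)
    have p1 : p ≠ φ₁ := by rintro rfl; exact R₁.not_both hp c2
    have p2 : p ≠ φ₂ := by rintro rfl; exact c3 (Or.inl hp)
    have hq' : (θ₁, q) ∈ R₂.neg := (M.hneg _ _ (by tauto)).1 hq
    have hp' : (θ₂, p) ∈ R₂.pos := (M.hpos _ _ (by tauto)).1 hp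
    have d4 : (θ₁, φ₂) ∈ R₂.pos := d4.resolve_right fun h => q2 (R₂.neg_col hq' h)
    have d3 : (θ₂, φ₂) ∈ R₂.neg := d3.resolve_left fun h => p2 (R₂.pos_col hp' h)
    have qo := M.col_out (Or.inr hq) (Or.inl rfl) q1 q2
    have po := M.col_out (Or.inl hp) (Or.inr rfl) p1 p2
    have z1 : ∀ x, (x, φ₂) ∉ R₁.neg := by
      intro x hx
      have x1 : x ≠ θ₁ := by rintro rfl; exact c4 (Or.inr hx)
      have x2 : x ≠ θ₂ := by rintro rfl; exact c3 (Or.inr hx)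
      exact x2 (R₂.neg_row ((M.hneg _ _ (by tauto)).1 hx) d3)
    have z2 : ∀ x, (x, φ₁) ∉ R₂.neg := by
      intro x hx
      have x1 : x ≠ θ₁ := by rintro rfl; exact d1 (Or.inr hx)
      have x2 : x ≠ θ₂ := by rintro rfl; exact d2 (Or.inr hx)
      exact x2 (R₁.neg_row ((M.hneg _ _ (by tauto)).2 hx) c2)
    refine M.finish 1 (-1) (by norm_num) ?_ ?_ ?_ ?_ ?_
    · intro φ
      rw [R₁.F_eq c1 hq, R₂.F_eq d4 hq', hI_add_right q φ₁ φ₂ φ qo]; ring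
    · intro φ
      rw [R₁.F_eq hp c2, R₂.F_eq hp' d3, hI_add_left p φ₁ φ₂ φ po]; ring
    · intro θ
      rw [R₂.G_zero z2, R₁.G_eq c2 c1, hI_compl _ _ _ hθ]; ring
    · intro θ
      rw [R₁.G_zero z1, R₂.G_eq d3 d4, hI_compl _ _ _ hθ]; ring
    · rw [R₁.F_eq c1 hq, R₁.F_eq c1 hq, R₁.G_eq c2 c1, R₁.G_eq c2 c1, hI_left _ _ hθ.symm,
        hI_right, hI_left _ _ q1.symm, hI_add_right q φ₁ φ₂ φ₂ qo, hI_right, hI_left _ _ q2.symm]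
      norm_num
  · -- negative at the left end
    have c2 : (θ₂, φ₁) ∈ R₁.pos := c2.resolve_right fun h => hθ (R₁.neg_row c1 h)
    obtain ⟨q, hq⟩ := R₁.col_neg_pos c1
    obtain ⟨p, hp⟩ := R₁.col_pos_neg c2
    have q1 : q ≠ φ₁ := by rintro rfl; exact R₁.not_both hq c1
    have q2 : q ≠ φ₂ := by rintro rfl; exact c4 (Or.inl hq)
    have p1 : p ≠ φ₁ := by rintro rfl; exact R₁.not_both c2 hp
    have p2 : p ≠ φ₂ := by rintro rfl; exact c3 (Or.inr hp)
    have hq' : (θ₁, q) ∈ R₂.pos := (M.hpos _ _ (by tauto)).1 hq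
    have hp' : (θ₂, p) ∈ R₂.neg := (M.hneg _ _ (by tauto)).1 hp
    have d4 : (θ₁, φ₂) ∈ R₂.neg := d4.resolve_left fun h => q2 (R₂.pos_col hq' h)
    have d3 : (θ₂, φ₂) ∈ R₂.pos := d3.resolve_right fun h => p2 (R₂.neg_col hp' h)
    have qo := M.col_out (Or.inl hq) (Or.inl rfl) q1 q2
    have po := M.col_out (Or.inr hp) (Or.inr rfl) p1 p2
    have z1 : ∀ x, (x, φ₂) ∉ R₁.neg := by
      intro x hx
      have x1 : x ≠ θ₁ := by rintro rfl; exact c4 (Or.inr hx)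
      have x2 : x ≠ θ₂ := by rintro rfl; exact c3 (Or.inr hx)
      exact x1 (R₂.neg_row ((M.hneg _ _ (by tauto)).1 hx) d4)
    have z2 : ∀ x, (x, φ₁) ∉ R₂.neg := by
      intro x hx
      have x1 : x ≠ θ₁ := by rintro rfl; exact d1 (Or.inr hx)
      have x2 : x ≠ θ₂ := by rintro rfl; exact d2 (Or.inr hx)
      exact x1 (R₁.neg_row ((M.hneg _ _ (by tauto)).2 hx) c1)
    refine M.finish 0 1 (by norm_num) ?_ ?_ ?_ ?_ ?_
    · intro φ
      rw [R₁.F_eq hq c1, R₂.F_eq hq' d4, hI_add_left q φ₁ φ₂ φ qo]; ring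
    · intro φ
      rw [R₁.F_eq c2 hp, R₂.F_eq d3 hp', hI_add_right p φ₁ φ₂ φ po]; ring
    · intro θ
      rw [R₂.G_zero z2, R₁.G_eq c1 c2]; ring
    · intro θ
      rw [R₁.G_zero z1, R₂.G_eq d4 d3]; ring
    · have := hI_add_left q φ₁ φ₂ φ₂ qo
      rw [hI_right, hI_right] at this
      rw [R₁.F_eq hq c1, R₁.F_eq hq c1, R₁.G_eq c1 c2, R₁.G_eq c1 c2, hI_left _ _ hθ,
        hI_right, hI_right]
      linarith

/-- Stabilization of type `→II` at the corner `(θ₁,φ₂)`. -/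
theorem stab (M : Mv R₁ R₂ θ₁ θ₂ φ₁ φ₂) (c1 : (θ₁, φ₁) ∉ R₁.verts) (c2 : (θ₂, φ₁) ∉ R₁.verts)
    (c3 : (θ₂, φ₂) ∉ R₁.verts) (c4 : (θ₁, φ₂) ∈ R₁.verts) (d3 : (θ₂, φ₂) ∈ R₂.neg) :
    SameInv R₁ R₂ := by
  have hθ := M.hθ
  have hφ := M.hφ
  have d1 : (θ₁, φ₁) ∈ R₂.verts := by
    by_contra h; exact c1 ((M.hcor _ _ (Or.inl rfl) (Or.inl rfl)).2 h)
  have d2 : (θ₂, φ₁) ∈ R₂.verts := by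
    by_contra h; exact c2 ((M.hcor _ _ (Or.inr rfl) (Or.inl rfl)).2 h)
  have d4 : (θ₁, φ₂) ∉ R₂.verts := (M.hcor _ _ (Or.inl rfl) (Or.inr rfl)).1 c4
  rw [RectDiagram.mem_verts] at c1 c2 c3 c4 d1 d2 d4
  have d2 : (θ₂, φ₁) ∈ R₂.pos := d2.resolve_right fun h => hφ (R₂.neg_col h d3)
  have d1 : (θ₁, φ₁) ∈ R₂.neg := d1.resolve_left fun h => hθ (R₂.pos_row h d2)
  obtain ⟨t, ht⟩ := R₂.row_neg_pos d3
  have t2 : t ≠ θ₂ := by rintro rfl; exact R₂.not_both ht d3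
  have t1 : t ≠ θ₁ := by rintro rfl; exact d4 (Or.inl ht)
  have ht' : (t, φ₂) ∈ R₁.pos := (M.hpos _ _ (by tauto)).2 ht
  have c4 : (θ₁, φ₂) ∈ R₁.neg := c4.resolve_left fun h => t1 (R₁.pos_row ht' h)
  obtain ⟨q, hq⟩ := R₁.col_neg_pos c4
  have q2 : q ≠ φ₂ := by rintro rfl; exact R₁.not_both hq c4
  have q1 : q ≠ φ₁ := by rintro rfl; exact c1 (Or.inl hq)
  have hq' : (θ₁, q) ∈ R₂.pos := (M.hpos _ _ (by tauto)).1 hq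
  have qo := M.col_out (Or.inl hq) (Or.inl rfl) q1 q2
  have tout := M.row_out (Or.inl ht') (Or.inr rfl) t1 t2
  have z1 : ∀ y, (θ₂, y) ∉ R₁.pos := by
    intro y hy
    have y1 : y ≠ φ₁ := by rintro rfl; exact c2 (Or.inl hy)
    have y2 : y ≠ φ₂ := by rintro rfl; exact c3 (Or.inl hy)
    exact y1 (R₂.pos_col ((M.hpos _ _ (by tauto)).1 hy) d2)
  have z2 : ∀ x, (x, φ₁) ∉ R₁.neg := by
    intro x hx
    have x1 : x ≠ θ₁ := by rintro rfl; exact c1 (Or.inr hx)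
    have x2 : x ≠ θ₂ := by rintro rfl; exact c2 (Or.inr hx)
    exact x1 (R₂.neg_row ((M.hneg _ _ (by tauto)).1 hx) d1)
  refine M.finish 0 (-1) (by norm_num) ?_ ?_ ?_ ?_ ?_
  · intro φ
    rw [R₁.F_eq hq c4, R₂.F_eq hq' d1, hI_add_left q φ₁ φ₂ φ qo]; ring
  · intro φ
    rw [R₁.F_zero z1, R₂.F_eq d2 d3]; ring
  · intro θ
    rw [R₁.G_zero z2, R₂.G_eq d1 d2]; ring
  · intro θ
    rw [R₁.G_eq c4 ht', R₂.G_eq d3 ht, hI_add_right t θ₁ θ₂ θ tout]; ring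
  · rw [R₁.F_eq hq c4, R₁.F_eq hq c4, R₁.G_zero z2, R₁.G_zero z2, hI_right,
      hI_add_left q φ₁ φ₂ φ₁ qo, hI_right, hI_left _ _ hφ]
    norm_num

end Mv

theorem pl1 (p1 n1 p2 n2 c : Prop)
    (a : ((p1 ∨ n1) ∧ ¬(p2 ∨ n2) ∨ (p2 ∨ n2) ∧ ¬(p1 ∨ n1)) ↔ c)
    (b : p1 ∧ (p2 ∨ n2) ↔ (p1 ∨ n1) ∧ p2) (h : ¬c) : p1 ↔ p2 := by tauto

theorem pl2 (p1 n1 p2 n2 c : Prop)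
    (a : ((p1 ∨ n1) ∧ ¬(p2 ∨ n2) ∨ (p2 ∨ n2) ∧ ¬(p1 ∨ n1)) ↔ c)
    (b : p1 ∧ (p2 ∨ n2) ↔ (p1 ∨ n1) ∧ p2) (d1 : p1 → n1 → False) (d2 : p2 → n2 → False)
    (h : ¬c) : n1 ↔ n2 := by tauto

theorem pl3 (A B C D : Prop) :
    (A ∧ C ∨ B ∧ C ∨ B ∧ D ∨ A ∧ D) ↔ (A ∨ B) ∧ (C ∨ D) := by tauto

theorem pl4 (v1 v2 c : Prop) (a : (v1 ∧ ¬v2 ∨ v2 ∧ ¬v1) ↔ c) (h : c) : v1 ↔ ¬v2 := by tauto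

theorem Mv.of_data {R₁ R₂ : RectDiagram} {θ₁ θ₂ φ₁ φ₂ : 𝕊}
    (h : ElemMoveData R₁ R₂ θ₁ θ₂ φ₁ φ₂) : Mv R₁ R₂ θ₁ θ₂ φ₁ φ₂ := by
  obtain ⟨hθ, hφ, hs, hr, -, hp⟩ := h
  have hs' : ∀ x y, ((x, y) ∈ R₁.verts ∧ (x, y) ∉ R₂.verts ∨ (x, y) ∈ R₂.verts ∧ (x, y) ∉ R₁.verts)
      ↔ ((x = θ₁ ∨ x = θ₂) ∧ (y = φ₁ ∨ y = φ₂)) := by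
    intro x y
    have := congrArg ((x, y) ∈ ·) hs
    simpa [Set.mem_symmDiff] using this
  have hp' : ∀ x y, ((x, y) ∈ R₁.pos ∧ (x, y) ∈ R₂.verts ↔ (x, y) ∈ R₁.verts ∧ (x, y) ∈ R₂.pos) := by
    intro x y
    have := congrArg ((x, y) ∈ ·) hp
    simpa using this
  refine ⟨hθ, hφ, ?_, ?_, ?_, ?_⟩
  · intro x y h
    have a := hs' x y
    have b := hp' x y
    rw [RectDiagram.mem_verts, RectDiagram.mem_verts] at a b
    exact pl1 _ _ _ _ _ a b h
  · intro x y h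
    have a := hs' x y
    have b := hp' x y
    rw [RectDiagram.mem_verts, RectDiagram.mem_verts] at a b
    exact pl2 _ _ _ _ _ a b R₁.not_both R₂.not_both h
  · intro x y hv h hx hy
    have : (x, y) ∈ (closedArc θ₁ θ₂ ×ˢ closedArc φ₁ φ₂) ∩
      ((↑R₁.verts : Set Torus) ∪ ↑R₂.verts) := ⟨⟨hx, hy⟩, by simpa using hv⟩
    rw [hr, hs] at this
    simp at this
    exact h this
  · intro x y hx hy
    exact pl4 _ _ _ (hs' x y) ⟨hx, hy⟩

open Classical in
theorem Mv.card {R₁ R₂ : RectDiagram} {θ₁ θ₂ φ₁ φ₂ : 𝕊} (M : Mv R₁ R₂ θ₁ θ₂ φ₁ φ₂) :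
    R₁.verts.card = (R₁.verts ∩ R₂.verts).card + ((if (θ₁, φ₁) ∈ R₁.verts then 1 else 0) +
      (if (θ₂, φ₁) ∈ R₁.verts then 1 else 0) + (if (θ₂, φ₂) ∈ R₁.verts then 1 else 0) +
      (if (θ₁, φ₂) ∈ R₁.verts then 1 else 0)) := by
  have hθ := M.hθ
  have hφ := M.hφ
  have e : R₁.verts \ R₂.verts =
      ({(θ₁, φ₁), (θ₂, φ₁), (θ₂, φ₂), (θ₁, φ₂)} : Finset Torus).filter (· ∈ R₁.verts) := by
    ext ⟨x, y⟩
    simp only [Finset.mem_sdiff, Finset.mem_filter, Finset.mem_insert,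
      Finset.mem_singleton, Prod.mk.injEq, pl3]
    constructor
    · rintro ⟨h1, h2⟩
      refine ⟨?_, h1⟩
      by_contra hc
      rw [RectDiagram.mem_verts, M.hpos x y hc, M.hneg x y hc, ← RectDiagram.mem_verts] at h1
      exact h2 h1
    · rintro ⟨⟨h1, h2⟩, h3⟩
      exact ⟨h3, (M.hcor x y h1 h2).1 h3⟩
  have h := Finset.card_inter_add_card_sdiff R₁.verts R₂.verts
  rw [e, Finset.card_filter, Finset.sum_insert, Finset.sum_insert, Finset.sum_insert,
    Finset.sum_singleton] at h
  · convert h.symm using 2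
    ring
  all_goals simp [hθ, hφ, hθ.symm, hφ.symm]

theorem corners {R₁ R₂ : RectDiagram} {θ₁ θ₂ φ₁ φ₂ : 𝕊}
    (h : ElemMoveData R₁ R₂ θ₁ θ₂ φ₁ φ₂) :
    ∃ s : Set Torus, ConsecCorners θ₁ θ₂ φ₁ φ₂ s ∧
      ((θ₁, φ₁) ∈ R₁.verts ↔ (θ₁, φ₁) ∈ s) ∧ ((θ₂, φ₁) ∈ R₁.verts ↔ (θ₂, φ₁) ∈ s) ∧
      ((θ₂, φ₂) ∈ R₁.verts ↔ (θ₂, φ₂) ∈ s) ∧ ((θ₁, φ₂) ∈ R₁.verts ↔ (θ₁, φ₂) ∈ s) := by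
  obtain ⟨hθ, hφ, hs, hr, ⟨s, hc, rfl, -⟩, hp⟩ := h
  exact ⟨_, hc, by simp, by simp, by simp, by simp⟩

theorem exch_inv {R₁ R₂ : RectDiagram} (h : ExchangeMove R₁ R₂) : SameInv R₁ R₂ := by
  classical
  obtain ⟨⟨θ₁, θ₂, φ₁, φ₂, h⟩, hcard⟩ := h
  have M := Mv.of_data h
  have hθ := M.hθ
  have hφ := M.hφ
  obtain ⟨s, hs, k1, k2, k3, k4⟩ := corners h
  have e1 := M.card
  have e2 := M.symm.card
  rw [Finset.inter_comm] at e2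
  have c1 := M.hcor _ _ (Or.inl rfl) (Or.inl rfl)
  have c2 := M.hcor _ _ (Or.inr rfl) (Or.inl rfl)
  have c3 := M.hcor _ _ (Or.inr rfl) (Or.inr rfl)
  have c4 := M.hcor _ _ (Or.inl rfl) (Or.inr rfl)
  have n1 := M.symm.hcor _ _ (Or.inl rfl) (Or.inl rfl)
  have n2 := M.symm.hcor _ _ (Or.inr rfl) (Or.inl rfl)
  have n3 := M.symm.hcor _ _ (Or.inr rfl) (Or.inr rfl)
  have n4 := M.symm.hcor _ _ (Or.inl rfl) (Or.inr rfl)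
  have key : ((θ₁, φ₁) ∈ R₁.verts ∧ (θ₂, φ₁) ∈ R₁.verts ∧ (θ₂, φ₂) ∉ R₁.verts ∧ (θ₁, φ₂) ∉ R₁.verts) ∨
      ((θ₁, φ₁) ∉ R₁.verts ∧ (θ₂, φ₁) ∈ R₁.verts ∧ (θ₂, φ₂) ∈ R₁.verts ∧ (θ₁, φ₂) ∉ R₁.verts) ∨
      ((θ₁, φ₁) ∉ R₁.verts ∧ (θ₂, φ₁) ∉ R₁.verts ∧ (θ₂, φ₂) ∈ R₁.verts ∧ (θ₁, φ₂) ∈ R₁.verts) ∨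
      ((θ₁, φ₁) ∈ R₁.verts ∧ (θ₂, φ₁) ∉ R₁.verts ∧ (θ₂, φ₂) ∉ R₁.verts ∧ (θ₁, φ₂) ∈ R₁.verts) := by
    rcases hs with rfl | rfl | rfl | rfl | rfl | rfl | rfl | rfl | rfl | rfl | rfl | rfl <;>
    · simp [hθ, hφ, hθ.symm, hφ.symm] at k1 k2 k3 k4
      grind
  rcases key with ⟨m1, m2, m3, m4⟩ | ⟨m1, m2, m3, m4⟩ | ⟨m1, m2, m3, m4⟩ | ⟨m1, m2, m3, m4⟩
  · exact M.exch m1 m2 m3 m4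
  · refine (SameInv.of_tr (M.symm.tr.exch ?_ ?_ ?_ ?_)).symm <;>
      rw [RectDiagram.mem_tr_verts]
    · exact n1.2 m1
    · exact n4.2 m4
    · exact fun h => n3.1 h m3
    · exact fun h => n2.1 h m2
  · exact (M.symm.exch (n1.2 m1) (n2.2 m2) (fun h => n3.1 h m3) (fun h => n4.1 h m4)).symm
  · refine SameInv.of_tr (M.tr.exch ?_ ?_ ?_ ?_) <;> rw [RectDiagram.mem_tr_verts] <;> assumption

theorem stab_inv' {R₁ R₂ : RectDiagram} {θ₁ θ₂ φ₁ φ₂ : 𝕊} (M : Mv R₁ R₂ θ₁ θ₂ φ₁ φ₂)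
    (hcard : R₂.verts.card = R₁.verts.card + 2)
    (ht : StabTypeData R₁ R₂ θ₁ θ₂ φ₁ φ₂ .rII) : SameInv R₁ R₂ := by
  classical
  have hθ := M.hθ
  have hφ := M.hφ
  have e1 := M.card
  have e2 := M.symm.card
  rw [Finset.inter_comm] at e2
  have c1 := M.hcor _ _ (Or.inl rfl) (Or.inl rfl)
  have c2 := M.hcor _ _ (Or.inr rfl) (Or.inl rfl)
  have c3 := M.hcor _ _ (Or.inr rfl) (Or.inr rfl)
  have c4 := M.hcor _ _ (Or.inl rfl) (Or.inr rfl)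
  obtain ⟨v, ⟨hv, -⟩, φ₀, h0, h1, h2, h3, h4⟩ := ht
  simp only [Finset.mem_coe] at hv
  simp only [Set.mem_insert_iff, Set.mem_singleton_iff] at h0
  rcases h3 with rfl | rfl
  · have key : (θ₁, φ₁) ∉ R₁.verts ∧ (θ₂, φ₁) ∉ R₁.verts ∧ (θ₂, φ₂) ∉ R₁.verts := by grind
    have h0 : φ₀ = φ₁ := by
      rcases h0 with rfl | rfl
      · rfl
      · exact (c4.1 hv h1).elim
    subst h0
    have d3 : (θ₂, φ₂) ∈ R₂.verts :=
      (M.symm.hcor _ _ (Or.inr rfl) (Or.inr rfl)).2 key.2.2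
    rw [RectDiagram.mem_verts] at d3
    exact M.stab key.1 key.2.1 key.2.2 hv (d3.resolve_left fun h => hφ (R₂.pos_col h4 h))
  · have key : (θ₁, φ₁) ∉ R₁.verts ∧ (θ₁, φ₂) ∉ R₁.verts ∧ (θ₂, φ₂) ∉ R₁.verts := by grind
    have h0 : φ₀ = φ₂ := by
      rcases h0 with rfl | rfl
      · exact (c2.1 hv h2).elim
      · rfl
    subst h0
    refine SameInv.of_tr (M.tr.stab ?_ ?_ ?_ ?_ ?_)
    · rw [RectDiagram.mem_tr_verts]; exact key.1
    · rw [RectDiagram.mem_tr_verts]; exact key.2.1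
    · rw [RectDiagram.mem_tr_verts]; exact key.2.2
    · rw [RectDiagram.mem_tr_verts]; exact hv
    · rw [RectDiagram.mem_tr_neg]; exact h4

theorem move_inv {R₁ R₂ : RectDiagram} (h : MoveOfType .rII R₁ R₂) : SameInv R₁ R₂ := by
  rcases h with h | ⟨θ₁, θ₂, φ₁, φ₂, h, hc, ht⟩ | ⟨θ₁, θ₂, φ₁, φ₂, h, hc, ht⟩
  · exact exch_inv h
  · exact stab_inv' (Mv.of_data h) hc ht
  · exact (stab_inv' (Mv.of_data h).symm hc ht).symm

theorem equiv_inv {R₁ R₂ : RectDiagram} (h : EquivOfType .rII R₁ R₂) : SameInv R₁ R₂ := by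
  induction h with
  | refl => exact ⟨rfl, rfl, rfl⟩
  | tail _ h ih =>
    have := move_inv h
    exact ⟨ih.1.trans this.1, ih.2.1.trans this.2.1, ih.2.2.trans this.2.2⟩

/-- an exchange move or a type `→II` (de)stabilization preserves the
number of double points of `Γ_→II`; consequently `ω_→II(R) = (k,l,m)` is an
invariant of the equivalence class `[R]_→II`. -/
theorem stmt9 :
    (∀ R₁ R₂ : RectDiagram, MoveOfType .rII R₁ R₂ →
      (DoublePts R₁).ncard = (DoublePts R₂).ncard) ∧
    (∀ R R' : RectDiagram, EquivOfType .rII R R' →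
      (DoublePts R).ncard = (DoublePts R').ncard ∧
      ∀ k l : ℕ, IsHomClass R k l ↔ IsHomClass R' k l) := by
  refine ⟨fun R₁ R₂ h => (move_inv h).1, fun R R' h => ?_⟩
  obtain ⟨h1, h2, h3⟩ := equiv_inv h
  refine ⟨h1, fun k l => ?_⟩
  rw [RectDiagram.isHomClass_iff, RectDiagram.isHomClass_iff, h2, h3]

end
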